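/- arXiv:math/0608652 — 2 statements merged into one kernel-verified Lean document; each statement's English description precedes it below -/
import Mathlib

section
/- Let X be a topological space, let Y be a compact metric space and Z a metric space, and let p : X → Y and q : Y → Z be continuous surjections. If p is a UV¹ map (with respect to the metric on Y) and q is a UV¹ map (with respect to the metric on Z), then the composition q ∘ p : X → Z is a UV¹ map (with respect to the metric on Z). -/
/-- `p : X → B` is a `UV¹(δ)` map: for every finite geometric simplicial complex `K`
realized in some Euclidean space, all of whose faces have at most 3 vertices,
every subcomplex `K₀` of `K`, and all continuous maps `α₀ : |K₀| → X`, `α : |K| → B`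
with `p ∘ α₀ = α` on `|K₀|`, there is a continuous `ᾱ : |K| → X` extending `α₀`
with `dist (p (ᾱ u)) (α u) < δ` for all `u ∈ |K|`. -/
def IsUV1MapAt {X B : Type*} [TopologicalSpace X] [MetricSpace B]
    (p : X → B) (δ : ℝ) : Prop :=
  ∀ (n : ℕ) (K K₀ : Geometry.SimplicialComplex ℝ (EuclideanSpace ℝ (Fin n))),
    K.faces.Finite →
    (∀ s ∈ K.faces, s.card ≤ 3) →
    K₀.faces ⊆ K.faces →
    ∀ (α₀ : K₀.space → X) (α : K.space → B),
      Continuous α₀ → Continuous α →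
      (∀ (u : K₀.space) (hu : (u : EuclideanSpace ℝ (Fin n)) ∈ K.space),
        p (α₀ u) = α ⟨u, hu⟩) →
      ∃ αbar : K.space → X, Continuous αbar ∧
        (∀ (u : K₀.space) (hu : (u : EuclideanSpace ℝ (Fin n)) ∈ K.space),
          αbar ⟨u, hu⟩ = α₀ u) ∧
        ∀ u : K.space, dist (p (αbar u)) (α u) < δ

/-- `p` is a `UV¹` map if it is `UV¹(δ)` for every `δ > 0`. -/
def IsUV1Map {X B : Type*} [TopologicalSpace X] [MetricSpace B]
    (p : X → B) : Prop :=
  ∀ δ : ℝ, 0 < δ → IsUV1MapAt p δ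

/-- The composition of `UV¹` maps (through a compact metric intermediate space)
is a `UV¹` map. -/
theorem uv1_comp {X Y Z : Type*} [TopologicalSpace X] [MetricSpace Y] [CompactSpace Y]
    [MetricSpace Z] (p : X → Y) (q : Y → Z)
    (hp_cont : Continuous p) (hp_surj : Function.Surjective p)
    (hq_cont : Continuous q) (hq_surj : Function.Surjective q)
    (hp : IsUV1Map p) (hq : IsUV1Map q) :
    IsUV1Map (q ∘ p) := by
  intro ε hε n K K₀ hfin hcard hsub α₀ α hα₀ hα hcomm
  obtain ⟨η, hη, hqη⟩ := Metric.uniformContinuous_iff.1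
    (CompactSpace.uniformContinuous_of_continuous hq_cont) (ε / 2) (half_pos hε)
  obtain ⟨β, hβ, hβ_ext, hβ_close⟩ := hq (ε / 2) (half_pos hε) n K K₀ hfin hcard hsub
    (p ∘ α₀) α (hp_cont.comp hα₀) hα hcomm
  obtain ⟨γ, hγ, hγ_ext, hγ_close⟩ := hp η hη n K K₀ hfin hcard hsub α₀ β hα₀ hβ
    fun u hu => (hβ_ext u hu).symm
  refine ⟨γ, hγ, hγ_ext, fun u => ?_⟩
  calc dist (q (p (γ u))) (α u)
      ≤ dist (q (p (γ u))) (q (β u)) + dist (q (β u)) (α u) := dist_triangle _ _ _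
    _ < ε / 2 + ε / 2 := add_lt_add (hqη (hγ_close u)) (hβ_close u)
    _ = ε := add_halves ε
end

section
/- Let X be a metric space, B a metric space, and p : X → B a continuous closed surjection all of whose fibers p⁻¹(b) are compact and are UV¹ subsets of X (so the fibers of p form an upper semicontinuous UV¹ decomposition of X with quotient space B). Then p is a UV¹ map, i.e. p is UV¹(δ) for every δ > 0. -/
/-- `A` is a `UV¹` subset of `X`: for every open `U ⊇ A` there is an open `V` with
`A ⊆ V ⊆ U` such that any two points of `V` are joined by a path in `U`, and every
loop in `V` is path-homotopic in `U` to a constant loop. -/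
def IsUV1Subset {X : Type*} [TopologicalSpace X] (A : Set X) : Prop :=
  ∀ U : Set X, IsOpen U → A ⊆ U →
    ∃ (V : Set X) (hVU : V ⊆ U), IsOpen V ∧ A ⊆ V ∧
      (∀ x ∈ V, ∀ y ∈ V, JoinedIn U x y) ∧
      (∀ (x : X) (hx : x ∈ V)
        (γ : Path (⟨x, hVU hx⟩ : U) (⟨x, hVU hx⟩ : U)),
        (∀ t, (γ t : X) ∈ V) →
        Path.Homotopic γ (Path.refl (⟨x, hVU hx⟩ : U)))

open Set Metric

theorem exists_continuousOn_union {Y X : Type*} [TopologicalSpace Y] [TopologicalSpace X]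
    {s t : Set Y} (hs : IsClosed s) (ht : IsClosed t) {f g : Y → X} (hf : ContinuousOn f s)
    (hg : ContinuousOn g t) (h : EqOn f g (s ∩ t)) :
    ∃ k : Y → X, ContinuousOn k (s ∪ t) ∧ EqOn k f s ∧ EqOn k g t := by
  classical
  have h₁ : EqOn (s.piecewise f g) f s := piecewise_eqOn s f g
  have h₂ : EqOn (s.piecewise f g) g t := fun z hz => by
    by_cases hzs : z ∈ s
    · rw [h₁ hzs, h ⟨hzs, hz⟩]
    · exact piecewise_eq_of_notMem s f g hzs
  exact ⟨s.piecewise f g, (hf.congr h₁).union_of_isClosed (hg.congr h₂) hs ht, h₁, h₂⟩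

theorem exists_continuousOn_image_of_factors {Y Z X : Type*} [TopologicalSpace Y]
    [TopologicalSpace Z] [T2Space Z] [TopologicalSpace X] {S : Set Y}
    (hS : IsCompact S) {q : Y → Z} (hq : ContinuousOn q S) {G : Y → X} (hG : ContinuousOn G S)
    (hfib : ∀ z ∈ S, ∀ w ∈ S, q z = q w → G z = G w) (f₀ : Z → X) :
    ∃ F : Z → X, ContinuousOn F (q '' S) ∧ ∀ z ∈ S, F (q z) = G z := by
  classical
  let F : Z → X := fun y => if h : ∃ z ∈ S, q z = y then G h.choose else f₀ y
  have hF : ∀ z ∈ S, F (q z) = G z := fun z hz => by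
    have h : ∃ w ∈ S, q w = q z := ⟨z, hz, rfl⟩
    simp only [F, dif_pos h]
    exact hfib _ h.choose_spec.1 _ hz h.choose_spec.2
  refine ⟨F, ?_, hF⟩
  rw [continuousOn_iff_isClosed]
  intro C hC
  obtain ⟨D, hD, hDS⟩ := continuousOn_iff_isClosed.1 hG C hC
  refine ⟨q '' (D ∩ S), ?_, ?_⟩
  · exact ((hS.inter_left hD).image_of_continuousOn (hq.mono inter_subset_right)).isClosed
  · rw [← hDS]
    ext y
    constructor
    · rintro ⟨hy, z, hz, rfl⟩
      exact ⟨⟨z, ⟨by simpa [hF z hz] using hy, hz⟩, rfl⟩, z, hz, rfl⟩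
    · rintro ⟨⟨z, ⟨hzC, hz⟩, rfl⟩, -⟩
      exact ⟨by simpa [hF z hz] using hzC, z, hz, rfl⟩

/-- Approximate lifts over `A` of the map `α` that are close enough to `α` extend to approximate
lifts over `S` within `ε` of `α`. -/
def ApproxExtends {X B Y : Type*} [TopologicalSpace X] [MetricSpace B] [TopologicalSpace Y]
    (p : X → B) (α : Y → B) (A S : Set Y) (ε : ℝ) : Prop :=
  ∃ η > 0, ∀ f : Y → X, ContinuousOn f A → (∀ z ∈ A, dist (p (f z)) (α z) < η) →
    ∃ F : Y → X, ContinuousOn F S ∧ EqOn F f A ∧ ∀ z ∈ S, dist (p (F z)) (α z) < ε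

namespace ApproxExtends

variable {X B Y Z : Type*} [TopologicalSpace X] [MetricSpace B] [TopologicalSpace Y]
  [TopologicalSpace Z] {p : X → B} {α : Y → B} {A S : Set Y} {ε : ℝ}

theorem self (hε : 0 < ε) : ApproxExtends p α S S ε :=
  ⟨ε, hε, fun f hf h => ⟨f, hf, fun _ _ => rfl, h⟩⟩

theorem singleton (hp : Function.Surjective p) (hε : 0 < ε) (y : Y) :
    ApproxExtends p α ∅ {y} ε := by
  obtain ⟨x, hx⟩ := hp (α y)
  exact ⟨1, one_pos, fun f _ _ => ⟨fun _ => x, continuousOn_const, fun _ h => h.elim, by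
    simpa [hx] using hε⟩⟩

theorem congr {β : Y → B} (h : ApproxExtends p α A S ε) (hAS : A ⊆ S) (hαβ : EqOn α β S) :
    ApproxExtends p β A S ε := by
  obtain ⟨η, hη, h⟩ := h
  refine ⟨η, hη, fun f hf hfβ => ?_⟩
  obtain ⟨F, hF, hFf, hFα⟩ := h f hf fun z hz => by rw [hαβ (hAS hz)]; exact hfβ z hz
  exact ⟨F, hF, hFf, fun z hz => by rw [← hαβ hz]; exact hFα z hz⟩

theorem image [T2Space Z] {q : Y → Z} {α : Z → B} {A' S' : Set Z}
    (h : ApproxExtends p (α ∘ q) A S ε) (hS : IsCompact S) (hAS : A ⊆ S) (hq : ContinuousOn q S)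
    (hfib : ∀ z ∈ S, ∀ w ∈ S, q z = q w → z = w ∨ z ∈ A ∧ w ∈ A)
    (hA' : q '' A = A') (hS' : q '' S = S') : ApproxExtends p α A' S' ε := by
  subst hA' hS'
  obtain ⟨η, hη, h⟩ := h
  refine ⟨η, hη, fun f hf hfα => ?_⟩
  obtain ⟨G, hG, hGf, hGα⟩ := h (f ∘ q) (hf.comp (hq.mono hAS) (mapsTo_image q A))
    fun z hz => hfα _ (mem_image_of_mem q hz)
  obtain ⟨F, hF, hFG⟩ := exists_continuousOn_image_of_factors hS hq hG (fun z hz w hw hzw => by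
    rcases hfib z hz w hw hzw with rfl | ⟨hzA, hwA⟩
    · rfl
    · rw [hGf hzA, hGf hwA, Function.comp_apply, Function.comp_apply, hzw]) f
  refine ⟨F, hF, ?_, ?_⟩
  · rintro _ ⟨z, hz, rfl⟩
    rw [hFG z (hAS hz), hGf hz, Function.comp_apply]
  · rintro _ ⟨z, hz, rfl⟩
    rw [hFG z hz]
    exact hGα z hz

theorem union {A₁ A₂ S₁ S₂ J : Set Y} (hA : IsClosed A) (hJ : IsClosed J)
    (hS₁ : IsClosed S₁) (hS₂ : IsClosed S₂)
    (hA₁ : A₁ ⊆ A ∪ J) (hA₂ : A₂ ⊆ A ∪ J) (hAA : A ⊆ A₁ ∪ A₂) (hAS₁ : A₁ ⊆ S₁) (hAS₂ : A₂ ⊆ S₂)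
    (hJ₁ : S₁ ∩ S₂ ⊆ A₁ ∩ A₂) (h₁ : ApproxExtends p α A₁ S₁ ε)
    (h₂ : ApproxExtends p α A₂ S₂ ε) (hE : ∀ ε' > 0, ApproxExtends p α (A ∩ J) J ε') :
    ApproxExtends p α A (S₁ ∪ S₂) ε := by
  obtain ⟨η₁, hη₁, h₁⟩ := h₁
  obtain ⟨η₂, hη₂, h₂⟩ := h₂
  obtain ⟨η, hη, h⟩ := hE (min η₁ η₂) (lt_min hη₁ hη₂)
  refine ⟨min η (min η₁ η₂), lt_min hη (lt_min hη₁ hη₂), fun f hf hfα => ?_⟩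
  obtain ⟨e, he, hef, heα⟩ := h f (hf.mono inter_subset_left) fun z hz =>
    (hfα z hz.1).trans_le (min_le_left _ _)
  obtain ⟨g, hg, hgf, hge⟩ := exists_continuousOn_union hA hJ hf he fun z hz => (hef hz).symm
  have hgα : ∀ z ∈ A ∪ J, dist (p (g z)) (α z) < min η₁ η₂ := by
    rintro z (hz | hz)
    · rw [hgf hz]; exact (hfα z hz).trans_le (min_le_right _ _)
    · rw [hge hz]; exact heα z hz
  obtain ⟨F₁, hF₁, hF₁g, hF₁α⟩ := h₁ g (hg.mono hA₁) fun z hz =>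
    (hgα z (hA₁ hz)).trans_le (min_le_left _ _)
  obtain ⟨F₂, hF₂, hF₂g, hF₂α⟩ := h₂ g (hg.mono hA₂) fun z hz =>
    (hgα z (hA₂ hz)).trans_le (min_le_right _ _)
  obtain ⟨F, hF, hFF₁, hFF₂⟩ := exists_continuousOn_union hS₁ hS₂ hF₁ hF₂ fun z hz => by
    rw [hF₁g (hJ₁ hz).1, hF₂g (hJ₁ hz).2]
  refine ⟨F, hF, fun z hz => ?_, ?_⟩
  · rcases hAA hz with hz' | hz'
    · rw [hFF₁ (hAS₁ hz'), hF₁g hz', hgf hz]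
    · rw [hFF₂ (hAS₂ hz'), hF₂g hz', hgf hz]
  · rintro z (hz | hz)
    · rw [hFF₁ hz]; exact hF₁α z hz
    · rw [hFF₂ hz]; exact hF₂α z hz

end ApproxExtends

/-- Path lifting and path-homotopy lifting up to `ε` over small balls of the base. -/
def HasLocalFillings {X B : Type*} [TopologicalSpace X] [MetricSpace B] (p : X → B) : Prop :=
  ∀ (b : B) (ε : ℝ), 0 < ε → ∃ η > 0, η ≤ ε ∧
    (∀ x y, p x ∈ ball b η → p y ∈ ball b η → ∃ γ : Path x y, ∀ t, p (γ t) ∈ ball b ε) ∧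
    ∀ (x y : X) (γ₁ γ₂ : Path x y), (∀ t, p (γ₁ t) ∈ ball b η) → (∀ t, p (γ₂ t) ∈ ball b η) →
      ∃ H : γ₁.Homotopy γ₂, ∀ z, p (H z) ∈ ball b ε

theorem IsClosedMap.exists_ball_preimage_subset {X B : Type*} [TopologicalSpace X] [MetricSpace B]
    {p : X → B} (hp : IsClosedMap p) {b : B} {V : Set X} (hV : IsOpen V) (hbV : p ⁻¹' {b} ⊆ V) :
    ∃ η > 0, p ⁻¹' ball b η ⊆ V := by
  have hO : IsOpen (p '' Vᶜ)ᶜ := (hp _ hV.isClosed_compl).isOpen_compl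
  have hb : b ∈ (p '' Vᶜ)ᶜ := by
    rintro ⟨x, hx, hxb⟩
    exact hx (hbV hxb)
  obtain ⟨η, hη, hsub⟩ := Metric.isOpen_iff.1 hO b hb
  refine ⟨η, hη, fun x hx => ?_⟩
  by_contra hxV
  exact hsub hx ⟨x, hxV, rfl⟩

theorem Path.Homotopic.of_trans_symm {X : Type*} [TopologicalSpace X] {x y : X} {γ₁ γ₂ : Path x y}
    (h : (γ₁.trans γ₂.symm).Homotopic (Path.refl x)) : γ₁.Homotopic γ₂ := by
  have h₁ : γ₁.Homotopic (γ₁.trans (γ₂.symm.trans γ₂)) :=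
    Path.Homotopic.trans ⟨(Path.Homotopy.transRefl γ₁).symm⟩
      (.hcomp (.refl γ₁) ⟨Path.Homotopy.reflSymmTrans γ₂⟩)
  have h₂ : (γ₁.trans (γ₂.symm.trans γ₂)).Homotopic ((γ₁.trans γ₂.symm).trans γ₂) :=
    ⟨(Path.Homotopy.transAssoc _ _ _).symm⟩
  have h₃ : ((γ₁.trans γ₂.symm).trans γ₂).Homotopic γ₂ :=
    (h.hcomp (.refl γ₂)).trans ⟨Path.Homotopy.reflTrans γ₂⟩
  exact (h₁.trans h₂).trans h₃

theorem hasLocalFillings_of_isUV1Subset {X B : Type*} [TopologicalSpace X] [MetricSpace B]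
    {p : X → B} (hp_cont : Continuous p) (hp_closed : IsClosedMap p)
    (h_uv1 : ∀ b : B, IsUV1Subset (p ⁻¹' {b})) : HasLocalFillings p := by
  intro b ε hε
  obtain ⟨V, hVU, hV, hbV, hjoin, hloop⟩ := h_uv1 b (p ⁻¹' ball b ε)
    (isOpen_ball.preimage hp_cont) (preimage_mono (by simpa using hε))
  obtain ⟨η, hη, hηV⟩ := hp_closed.exists_ball_preimage_subset hV hbV
  refine ⟨min η ε, lt_min hη hε, min_le_right _ _, fun x y hx hy => ?_,
    fun x y γ₁ γ₂ h₁ h₂ => ?_⟩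
  · have h : JoinedIn _ x y := hjoin x (hηV (ball_subset_ball (min_le_left _ _) hx)) y
      (hηV (ball_subset_ball (min_le_left _ _) hy))
    exact ⟨h.somePath, h.somePath_mem⟩
  · have hV₁ : ∀ t, γ₁ t ∈ V := fun t => hηV (ball_subset_ball (min_le_left _ _) (h₁ t))
    have hV₂ : ∀ t, γ₂ t ∈ V := fun t => hηV (ball_subset_ball (min_le_left _ _) (h₂ t))
    have hx : x ∈ V := by simpa using hV₁ 0
    have hy : y ∈ V := by simpa using hV₁ 1
    let U := p ⁻¹' ball b ε
    let δ₁ : Path (⟨x, hVU hx⟩ : U) ⟨y, hVU hy⟩ :=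
      { toFun := fun t => ⟨γ₁ t, hVU (hV₁ t)⟩, continuous_toFun := by fun_prop
        source' := by simp, target' := by simp }
    let δ₂ : Path (⟨x, hVU hx⟩ : U) ⟨y, hVU hy⟩ :=
      { toFun := fun t => ⟨γ₂ t, hVU (hV₂ t)⟩, continuous_toFun := by fun_prop
        source' := by simp, target' := by simp }
    obtain ⟨H⟩ : δ₁.Homotopic δ₂ := by
      refine Path.Homotopic.of_trans_symm (hloop x hx _ fun t => ?_)
      rw [Path.trans_apply]
      split_ifs
      · exact hV₁ _
      · exact hV₂ _
    refine ⟨(H.map ⟨Subtype.val, continuous_subtype_val⟩).cast ?_ ?_, fun z => (H z).2⟩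
    · ext; rfl
    · ext; rfl

theorem image_lineMap_Icc {a b : ℝ} (hab : a ≤ b) :
    AffineMap.lineMap a b '' Icc (0 : ℝ) 1 = Icc a b := by
  rw [← segment_eq_image_lineMap, segment_eq_Icc hab]

namespace HasLocalFillings

variable {X B : Type*} [TopologicalSpace X] [MetricSpace B] {p : X → B} {ε : ℝ}

theorem exists_approxExtends_unitInterval (hp : HasLocalFillings p) (b : B) (hε : 0 < ε) :
    ∃ ρ > 0, ∀ α : ℝ → B, (∀ t ∈ Icc (0 : ℝ) 1, α t ∈ ball b ρ) →
      ApproxExtends p α {0, 1} (Icc 0 1) ε := by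
  obtain ⟨η, hη, hηε, hjoin, -⟩ := hp b (ε / 2) (half_pos hε)
  refine ⟨η / 2, half_pos hη, fun α hα => ⟨η / 2, half_pos hη, fun f _ hf => ?_⟩⟩
  have hball : ∀ t ∈ ({0, 1} : Set ℝ), p (f t) ∈ ball b η := fun t ht => by
    have h₁ := hf t ht
    have h₂ := hα t (by rcases ht with rfl | rfl <;> simp)
    rw [mem_ball] at h₂ ⊢
    linarith [dist_triangle (p (f t)) (α t) b]
  obtain ⟨γ, hγ⟩ := hjoin (f 0) (f 1) (hball 0 (by simp)) (hball 1 (by simp))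
  refine ⟨fun t => γ (projIcc 0 1 zero_le_one t), by fun_prop, ?_, fun t ht => ?_⟩
  · rintro t (rfl | rfl) <;> simp
  · have h₁ := hγ (projIcc 0 1 zero_le_one t)
    have h₂ := hα t ht
    rw [mem_ball] at h₁ h₂
    rw [dist_comm] at h₂
    linarith [dist_triangle (p (γ (projIcc 0 1 zero_le_one t))) b (α t)]

theorem exists_approxExtends_Icc (hp : HasLocalFillings p) (b : B) (hε : 0 < ε) :
    ∃ ρ > 0, ∀ (α : ℝ → B) (c d : ℝ), c ≤ d → (∀ t ∈ Icc c d, α t ∈ ball b ρ) →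
      ApproxExtends p α {c, d} (Icc c d) ε := by
  obtain ⟨ρ, hρ, h⟩ := hp.exists_approxExtends_unitInterval b hε
  refine ⟨ρ, hρ, fun α c d hcd hα => ?_⟩
  rcases hcd.eq_or_lt with rfl | hcd'
  · simpa using ApproxExtends.self hε
  have himg := image_lineMap_Icc hcd
  refine (h (α ∘ AffineMap.lineMap c d) fun t ht => hα _ ?_).image isCompact_Icc ?_
    (by fun_prop) (fun z _ w _ hzw => .inl (AffineMap.lineMap_injective ℝ hcd'.ne hzw))
    (by simp [image_pair]) himg
  · rw [← himg]
    exact mem_image_of_mem _ ht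
  · rintro t (rfl | rfl) <;> simp

theorem approxExtends_Icc (hp : HasLocalFillings p) (hsurj : Function.Surjective p)
    {α : ℝ → B} (hα : Continuous α) {c d : ℝ} (hcd : c ≤ d) (hε : 0 < ε) :
    ApproxExtends p α {c, d} (Icc c d) ε := by
  choose ρ hρ h using fun b => hp.exists_approxExtends_Icc b hε
  obtain ⟨t, ht₀, htm, ⟨m, hm⟩, ht⟩ := exists_monotone_Icc_subset_open_cover_Icc hcd
    (c := fun s : Icc c d => {w | α w ∈ ball (α s) (ρ (α s))})
    (fun s => isOpen_ball.preimage (by fun_prop))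
    (fun s _ => mem_iUnion.2 ⟨s, mem_ball_self (hρ _)⟩)
  have key : ∀ n, ApproxExtends p α {c, (t n : ℝ)} (Icc c (t n)) ε := by
    intro n
    induction n with
    | zero => simpa [ht₀] using ApproxExtends.self hε
    | succ n ih =>
      obtain ⟨s, hs⟩ := ht n
      have hle : (t n : ℝ) ≤ t (n + 1) := htm n.le_succ
      have hcn : c ≤ t n := (t n).2.1
      have hstep : ApproxExtends p α {(t n : ℝ), (t (n + 1) : ℝ)} (Icc (t n) (t (n + 1))) ε :=
        h (α s) α _ _ hle fun u hu =>
          hs (a := ⟨u, hcn.trans hu.1, hu.2.trans (t (n + 1)).2.2⟩) hu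
      rw [← Icc_union_Icc_eq_Icc hcn hle]
      refine ih.union (J := {(t n : ℝ)}) (Set.toFinite _).isClosed isClosed_singleton isClosed_Icc
        isClosed_Icc (by grind) (by grind) (by grind) (by grind) (by grind) ?_ hstep ?_
      · rintro u ⟨hu₁, hu₂⟩
        have : u = t n := le_antisymm hu₁.2 hu₂.1
        simp [this]
      · intro ε' hε'
        by_cases hmem : (t n : ℝ) ∈ ({c, (t (n + 1) : ℝ)} : Set ℝ)
        · rw [inter_eq_right.2 (singleton_subset_iff.2 hmem)]
          exact .self hε'
        · rw [inter_singleton_eq_empty.2 hmem]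
          exact .singleton hsurj hε' _
  simpa [hm m le_rfl] using key m

end HasLocalFillings

/-- The rectangle `[a, b] × [c, d]`. -/
abbrev rect (a b c d : ℝ) : Set (ℝ × ℝ) := Icc a b ×ˢ Icc c d

/-- The boundary of the rectangle `[a, b] × [c, d]`. -/
def rectBoundary (a b c d : ℝ) : Set (ℝ × ℝ) :=
  {z ∈ rect a b c d | z.1 = a ∨ z.1 = b ∨ z.2 = c ∨ z.2 = d}

theorem rectBoundary_subset (a b c d : ℝ) : rectBoundary a b c d ⊆ rect a b c d :=
  fun _ h => h.1

theorem isClosed_rect (a b c d : ℝ) : IsClosed (rect a b c d) := isClosed_Icc.prod isClosed_Icc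

theorem isCompact_rect (a b c d : ℝ) : IsCompact (rect a b c d) := isCompact_Icc.prod isCompact_Icc

theorem isClosed_rectBoundary (a b c d : ℝ) : IsClosed (rectBoundary a b c d) := by
  have h : rectBoundary a b c d = rect a b c d ∩
      ({z | z.1 = a} ∪ ({z | z.1 = b} ∪ ({z | z.2 = c} ∪ {z | z.2 = d}))) := rfl
  rw [h]
  exact (isClosed_rect a b c d).inter ((isClosed_eq (by fun_prop) (by fun_prop)).union
    ((isClosed_eq (by fun_prop) (by fun_prop)).union
      ((isClosed_eq (by fun_prop) (by fun_prop)).union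
        (isClosed_eq (by fun_prop) (by fun_prop)))))

/-- For `0 ≤ t ≤ 1`, the slice of the unit square by `x + y = 2 t`, run through as `s` goes from `0`
to `1`. -/
def squareSweep (z : ℝ × ℝ) : ℝ × ℝ :=
  ((1 - z.1) * min (2 * z.2) 1 + z.1 * max (2 * z.2 - 1) 0,
    (1 - z.1) * max (2 * z.2 - 1) 0 + z.1 * min (2 * z.2) 1)

theorem continuous_squareSweep : Continuous squareSweep := by
  unfold squareSweep; fun_prop

theorem min_add_max_eq (t : ℝ) : min (2 * t) 1 + max (2 * t - 1) 0 = 2 * t := by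
  rcases le_total (2 * t) 1 with h | h
  · rw [min_eq_left h, max_eq_right (by linarith)]; ring
  · rw [min_eq_right h, max_eq_left (by linarith)]; ring

theorem max_lt_min_of_mem_Ioo {t : ℝ} (ht : t ∈ Ioo (0 : ℝ) 1) :
    max (2 * t - 1) 0 < min (2 * t) 1 := by
  obtain ⟨h₀, h₁⟩ := ht
  simp only [max_lt_iff, lt_min_iff]
  exact ⟨⟨by linarith, by linarith⟩, by linarith, one_pos⟩

theorem surjOn_squareSweep : SurjOn squareSweep (rect 0 1 0 1) (rect 0 1 0 1) := by
  rintro ⟨x, y⟩ ⟨⟨hx₀, hx₁⟩, hy₀, hy₁⟩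
  simp only at hx₀ hx₁ hy₀ hy₁
  have hsum := min_add_max_eq ((x + y) / 2)
  by_cases ht : (x + y) / 2 ∈ Ioo (0 : ℝ) 1
  · have hlt := max_lt_min_of_mem_Ioo ht
    have hxm : x ≤ min (2 * ((x + y) / 2)) 1 := le_min (by linarith) hx₁
    have hxn : max (2 * ((x + y) / 2) - 1) 0 ≤ x := max_le (by linarith) hx₀
    set m := min (2 * ((x + y) / 2)) 1 with hm
    set n := max (2 * ((x + y) / 2) - 1) 0 with hn
    have hpos : 0 < m - n := sub_pos.2 hlt
    have hs : (m - x) / (m - n) * (m - n) = m - x := div_mul_cancel₀ _ hpos.ne'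
    refine ⟨((m - x) / (m - n), (x + y) / 2), ⟨⟨?_, ?_⟩, ht.1.le, ht.2.le⟩, ?_⟩
    · exact div_nonneg (by linarith) hpos.le
    · exact (div_le_one hpos).2 (by linarith)
    · simp only [squareSweep, ← hm, ← hn, Prod.mk.injEq]
      exact ⟨by linear_combination -hs, by linear_combination hs + hsum⟩
  · have hcase : (x = 0 ∧ y = 0) ∨ (x = 1 ∧ y = 1) := by
      rw [mem_Ioo, not_and_or, not_lt, not_lt] at ht
      rcases ht with h | h
      · exact .inl ⟨by linarith, by linarith⟩
      · exact .inr ⟨by linarith, by linarith⟩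
    rcases hcase with ⟨rfl, rfl⟩ | ⟨rfl, rfl⟩
    · exact ⟨(0, 0), by simp, by simp [squareSweep]⟩
    · exact ⟨(0, 1), by simp, by norm_num [squareSweep]⟩

theorem eq_or_of_squareSweep_eq {z w : ℝ × ℝ} (hz : z ∈ rect 0 1 0 1)
    (h : squareSweep z = squareSweep w) : z = w ∨ z.2 = w.2 ∧ (z.2 = 0 ∨ z.2 = 1) := by
  simp only [squareSweep, Prod.mk.injEq] at h
  have ht : z.2 = w.2 := by
    linear_combination (h.1 + h.2 - min_add_max_eq z.2 + min_add_max_eq w.2) / 2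
  by_cases hmem : z.2 ∈ Ioo (0 : ℝ) 1
  · have hlt := max_lt_min_of_mem_Ioo hmem
    rw [← ht] at h
    refine .inl (Prod.ext (mul_right_cancel₀ (sub_pos.2 hlt).ne' ?_) ht)
    linear_combination -h.1
  · refine .inr ⟨ht, ?_⟩
    rw [mem_Ioo, not_and_or, not_lt, not_lt] at hmem
    exact hmem.imp (fun h => le_antisymm h hz.2.1) fun h => le_antisymm hz.2.2 h

theorem mem_rectBoundary_min_max {t : ℝ} (ht : t ∈ Icc (0 : ℝ) 1) :
    (min (2 * t) 1, max (2 * t - 1) 0) ∈ rectBoundary 0 1 0 1 ∧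
      (max (2 * t - 1) 0, min (2 * t) 1) ∈ rectBoundary 0 1 0 1 := by
  obtain ⟨h₀, h₁⟩ := ht
  have hm : min (2 * t) 1 ∈ Icc (0 : ℝ) 1 := ⟨le_min (by linarith) zero_le_one, min_le_right _ _⟩
  have hn : max (2 * t - 1) 0 ∈ Icc (0 : ℝ) 1 :=
    ⟨le_max_right _ _, max_le (by linarith) zero_le_one⟩
  rcases le_total (2 * t) 1 with h | h
  · have : max (2 * t - 1) 0 = 0 := max_eq_right (by linarith)
    exact ⟨⟨⟨hm, hn⟩, by simp [this]⟩, ⟨⟨hn, hm⟩, by simp [this]⟩⟩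
  · have : min (2 * t) 1 = 1 := min_eq_right h
    exact ⟨⟨⟨hm, hn⟩, by simp [this]⟩, ⟨⟨hn, hm⟩, by simp [this]⟩⟩

theorem exists_squareSweep_eq_of_mem_rectBoundary {z : ℝ × ℝ} (hz : z ∈ rectBoundary 0 1 0 1) :
    ∃ t ∈ Icc (0 : ℝ) 1, z = (min (2 * t) 1, max (2 * t - 1) 0) ∨
      z = (max (2 * t - 1) 0, min (2 * t) 1) := by
  obtain ⟨x, y⟩ := z
  obtain ⟨⟨⟨hx₀, hx₁⟩, hy₀, hy₁⟩, h⟩ := hz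
  simp only at hx₀ hx₁ hy₀ hy₁ h
  have hlow : ∀ u : ℝ, 0 ≤ u → u ≤ 1 → u / 2 ∈ Icc (0 : ℝ) 1 ∧ min (2 * (u / 2)) 1 = u ∧
      max (2 * (u / 2) - 1) 0 = 0 := fun u h₀ h₁ =>
    ⟨⟨by linarith, by linarith⟩, by rw [min_eq_left] <;> linarith, max_eq_right (by linarith)⟩
  have hhigh : ∀ u : ℝ, 0 ≤ u → u ≤ 1 → (1 + u) / 2 ∈ Icc (0 : ℝ) 1 ∧
      min (2 * ((1 + u) / 2)) 1 = 1 ∧ max (2 * ((1 + u) / 2) - 1) 0 = u := fun u h₀ h₁ =>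
    ⟨⟨by linarith, by linarith⟩, min_eq_right (by linarith), by rw [max_eq_left] <;> linarith⟩
  rcases h with rfl | rfl | rfl | rfl
  · obtain ⟨h₁, h₂, h₃⟩ := hlow y hy₀ hy₁
    exact ⟨_, h₁, .inr (by rw [h₂, h₃])⟩
  · obtain ⟨h₁, h₂, h₃⟩ := hhigh y hy₀ hy₁
    exact ⟨_, h₁, .inl (by rw [h₂, h₃])⟩
  · obtain ⟨h₁, h₂, h₃⟩ := hlow x hx₀ hx₁
    exact ⟨_, h₁, .inl (by rw [h₂, h₃])⟩
  · obtain ⟨h₁, h₂, h₃⟩ := hhigh x hx₀ hx₁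
    exact ⟨_, h₁, .inr (by rw [h₂, h₃])⟩

/-- A map on the boundary of the unit square extends over the square, inside `p ⁻¹' N`, as soon as
paths with common endpoints in `p ⁻¹' M` are homotopic in `p ⁻¹' N`. -/
theorem exists_continuousOn_unitSquare {X B : Type*} [TopologicalSpace X] {p : X → B} {M N : Set B}
    (hMN : ∀ (x y : X) (γ₁ γ₂ : Path x y), (∀ t, p (γ₁ t) ∈ M) → (∀ t, p (γ₂ t) ∈ M) →
      ∃ H : γ₁.Homotopy γ₂, ∀ z, p (H z) ∈ N)
    {f : ℝ × ℝ → X} (hf : ContinuousOn f (rectBoundary 0 1 0 1))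
    (hfM : ∀ z ∈ rectBoundary 0 1 0 1, p (f z) ∈ M) :
    ∃ F : ℝ × ℝ → X, ContinuousOn F (rect 0 1 0 1) ∧ EqOn F f (rectBoundary 0 1 0 1) ∧
      ∀ z ∈ rect 0 1 0 1, p (F z) ∈ N := by
  let γ₁ : Path (f (0, 0)) (f (1, 1)) :=
    { toFun := fun t => f (min (2 * (t : ℝ)) 1, max (2 * (t : ℝ) - 1) 0)
      continuous_toFun := hf.comp_continuous (by fun_prop)
        fun t => (mem_rectBoundary_min_max t.2).1
      source' := by simp
      target' := by norm_num }
  let γ₂ : Path (f (0, 0)) (f (1, 1)) :=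
    { toFun := fun t => f (max (2 * (t : ℝ) - 1) 0, min (2 * (t : ℝ)) 1)
      continuous_toFun := hf.comp_continuous (by fun_prop)
        fun t => (mem_rectBoundary_min_max t.2).2
      source' := by simp
      target' := by norm_num }
  obtain ⟨H, hH⟩ := hMN _ _ γ₁ γ₂ (fun t => hfM _ (mem_rectBoundary_min_max t.2).1)
    fun t => hfM _ (mem_rectBoundary_min_max t.2).2
  let proj : ℝ → unitInterval := projIcc 0 1 zero_le_one
  obtain ⟨F, hF, hFH⟩ := exists_continuousOn_image_of_factors (isCompact_rect 0 1 0 1)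
    continuous_squareSweep.continuousOn (G := fun z => H (proj z.1, proj z.2))
    (by fun_prop) (fun z hz w _ hzw => by
      rcases eq_or_of_squareSweep_eq hz hzw with rfl | ⟨h₁, h₂ | h₂⟩
      · rfl
      · simp [← h₁, h₂, proj]
      · simp [← h₁, h₂, proj]) f
  refine ⟨F, hF.mono surjOn_squareSweep, fun z hz => ?_, fun z hz => ?_⟩
  · obtain ⟨t, ht, rfl | rfl⟩ := exists_squareSweep_eq_of_mem_rectBoundary hz
    · have h := hFH (0, t) ⟨by simp, ht⟩
      simp only [squareSweep, sub_zero, one_mul, zero_mul, add_zero] at h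
      rw [h]
      simp [proj, γ₁, projIcc_of_mem _ ht]
    · have h := hFH (1, t) ⟨by simp, ht⟩
      simp only [squareSweep, sub_self, one_mul, zero_mul, zero_add] at h
      rw [h]
      simp [proj, γ₂, projIcc_of_mem _ ht]
  · obtain ⟨w, hw, rfl⟩ := surjOn_squareSweep hz
    rw [hFH w hw]
    exact hH _

theorem rectBoundary_eq_rect_of_eq {a b c d : ℝ} (h : a = b ∨ c = d) :
    rectBoundary a b c d = rect a b c d := by
  refine (rectBoundary_subset a b c d).antisymm fun z hz => ⟨hz, ?_⟩
  rcases h with rfl | rfl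
  · exact .inl (le_antisymm hz.1.2 hz.1.1)
  · exact .inr (.inr (.inl (le_antisymm hz.2.2 hz.2.1)))

theorem image_swap_rectBoundary (a b c d : ℝ) :
    Prod.swap '' rectBoundary a b c d = rectBoundary c d a b := by
  ext ⟨x, y⟩
  simp only [mem_image, rectBoundary, mem_ofPred_eq, Prod.exists, Prod.swap_prod_mk, Prod.mk.injEq,
    mem_prod, mem_Icc]
  grind

theorem image_lineMap_rect {a b c d : ℝ} (hab : a ≤ b) (hcd : c ≤ d) :
    Prod.map (AffineMap.lineMap a b) (AffineMap.lineMap c d) '' rect (0 : ℝ) 1 0 1 =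
      rect a b c d := by
  rw [rect, prodMap_image_prod, image_lineMap_Icc hab, image_lineMap_Icc hcd]

theorem image_lineMap_rectBoundary {a b c d : ℝ} (hab : a < b) (hcd : c < d) :
    Prod.map (AffineMap.lineMap a b) (AffineMap.lineMap c d) '' rectBoundary (0 : ℝ) 1 0 1 =
      rectBoundary a b c d := by
  have himg := image_lineMap_rect hab.le hcd.le
  apply Subset.antisymm
  · rintro _ ⟨z, ⟨hz, h⟩, rfl⟩
    refine ⟨himg ▸ mem_image_of_mem _ hz, ?_⟩
    rcases h with h | h | h | h <;> simp [h]
  · rintro z ⟨hz, h⟩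
    rw [← himg] at hz
    obtain ⟨w, hw, rfl⟩ := hz
    refine ⟨w, ⟨hw, ?_⟩, rfl⟩
    simpa [hab.ne', hab.ne, hcd.ne, hcd.ne'] using h

namespace HasLocalFillings

variable {X B : Type*} [TopologicalSpace X] [MetricSpace B] {p : X → B} {ε : ℝ}

theorem exists_approxExtends_unitSquare (hp : HasLocalFillings p) (b : B) (hε : 0 < ε) :
    ∃ ρ > 0, ∀ α : ℝ × ℝ → B, (∀ z ∈ rect 0 1 0 1, α z ∈ ball b ρ) →
      ApproxExtends p α (rectBoundary 0 1 0 1) (rect 0 1 0 1) ε := by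
  obtain ⟨η, hη, hηε, -, hfill⟩ := hp b (ε / 2) (half_pos hε)
  refine ⟨η / 2, half_pos hη, fun α hα => ⟨η / 2, half_pos hη, fun f hf hfα => ?_⟩⟩
  obtain ⟨F, hF, hFf, hFb⟩ := exists_continuousOn_unitSquare hfill hf fun z hz => by
    have h₁ := hfα z hz
    have h₂ := hα z hz.1
    rw [mem_ball] at h₂ ⊢
    linarith [dist_triangle (p (f z)) (α z) b]
  refine ⟨F, hF, hFf, fun z hz => ?_⟩
  have h₁ := hFb z hz
  have h₂ := hα z hz
  rw [mem_ball] at h₁ h₂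
  rw [dist_comm] at h₂
  linarith [dist_triangle (p (F z)) b (α z)]

theorem exists_approxExtends_rect (hp : HasLocalFillings p) (b₀ : B) (hε : 0 < ε) :
    ∃ ρ > 0, ∀ (α : ℝ × ℝ → B) (a b c d : ℝ), a ≤ b → c ≤ d →
      (∀ z ∈ rect a b c d, α z ∈ ball b₀ ρ) →
      ApproxExtends p α (rectBoundary a b c d) (rect a b c d) ε := by
  obtain ⟨ρ, hρ, h⟩ := hp.exists_approxExtends_unitSquare b₀ hε
  refine ⟨ρ, hρ, fun α a b c d hab hcd hα => ?_⟩
  by_cases hdeg : a = b ∨ c = d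
  · rw [rectBoundary_eq_rect_of_eq hdeg]
    exact .self hε
  · rw [not_or] at hdeg
    have hinj := (AffineMap.lineMap_injective ℝ hdeg.1).prodMap
      (AffineMap.lineMap_injective ℝ hdeg.2)
    refine (h (α ∘ Prod.map (AffineMap.lineMap a b) (AffineMap.lineMap c d)) fun z hz =>
      hα _ ?_).image (isCompact_rect 0 1 0 1) (rectBoundary_subset 0 1 0 1)
      (Continuous.continuousOn (by fun_prop)) (fun z _ w _ hzw => .inl (hinj hzw))
      (image_lineMap_rectBoundary (hab.lt_of_ne hdeg.1) (hcd.lt_of_ne hdeg.2))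
      (image_lineMap_rect hab hcd)
    rw [← image_lineMap_rect hab hcd]
    exact mem_image_of_mem _ hz

theorem approxExtends_rect_union (hp : HasLocalFillings p) (hsurj : Function.Surjective p)
    {α : ℝ × ℝ → B} (hα : Continuous α) {a m b c d : ℝ} (ham : a ≤ m) (hmb : m ≤ b) (hcd : c ≤ d)
    (h₁ : ApproxExtends p α (rectBoundary a m c d) (rect a m c d) ε)
    (h₂ : ApproxExtends p α (rectBoundary m b c d) (rect m b c d) ε) :
    ApproxExtends p α (rectBoundary a b c d) (rect a b c d) ε := by
  have hrect : rect a b c d = rect a m c d ∪ rect m b c d := by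
    rw [rect, rect, rect, ← union_prod, Icc_union_Icc_eq_Icc ham hmb]
  have hmem : ∀ (a b c d : ℝ) (z : ℝ × ℝ), z ∈ rectBoundary a b c d ↔
      ((a ≤ z.1 ∧ z.1 ≤ b) ∧ c ≤ z.2 ∧ z.2 ≤ d) ∧ (z.1 = a ∨ z.1 = b ∨ z.2 = c ∨ z.2 = d) :=
    fun _ _ _ _ _ => Iff.rfl
  have hJ : ∀ z : ℝ × ℝ, z ∈ ({m} : Set ℝ) ×ˢ Icc c d ↔ z.1 = m ∧ c ≤ z.2 ∧ z.2 ≤ d :=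
    fun _ => Iff.rfl
  rw [hrect]
  refine ApproxExtends.union (J := {m} ×ˢ Icc c d) (isClosed_rectBoundary _ _ _ _)
    (isClosed_singleton.prod isClosed_Icc) (isClosed_rect _ _ _ _) (isClosed_rect _ _ _ _)
    (fun z hz => ?_) (fun z hz => ?_) (fun z hz => ?_) (rectBoundary_subset _ _ _ _)
    (rectBoundary_subset _ _ _ _) (fun z hz => ?_) h₁ h₂ fun ε' hε' => ?_
  · rw [mem_union, hmem, hJ]; rw [hmem] at hz; grind
  · rw [mem_union, hmem, hJ]; rw [hmem] at hz; grind
  · rw [mem_union, hmem, hmem]; rw [hmem] at hz; grind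
  · have : z.1 = m := le_antisymm hz.1.1.2 hz.2.1.1
    exact ⟨⟨hz.1, .inr (.inl this)⟩, hz.2, .inl this⟩
  · by_cases hm : m = a ∨ m = b
    · rw [inter_eq_right.2]
      · exact .self hε'
      · intro z hz
        rw [hmem]; rw [hJ] at hz; grind
    · refine (hp.approxExtends_Icc hsurj (α := α ∘ Prod.mk m) (by fun_prop) hcd hε').image
        isCompact_Icc ?_ (Continuous.continuousOn (by fun_prop))
        (fun z _ w _ hzw => .inl (Prod.mk_right_injective m hzw)) ?_ ?_
      · rintro t (rfl | rfl) <;> simp [hcd]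
      · ext z
        rw [image_pair, mem_inter_iff, hmem, hJ]
        simp only [mem_insert_iff, mem_singleton_iff, Prod.ext_iff]
        grind
      · exact singleton_prod.symm

theorem approxExtends_rect_swap {α : ℝ × ℝ → B} {a b c d : ℝ}
    (h : ApproxExtends p (α ∘ Prod.swap) (rectBoundary a b c d) (rect a b c d) ε) :
    ApproxExtends p α (rectBoundary c d a b) (rect c d a b) ε :=
  h.image (isCompact_rect _ _ _ _) (rectBoundary_subset _ _ _ _) continuous_swap.continuousOn
    (fun _ _ _ _ hzw => .inl (Prod.swap_injective hzw)) (image_swap_rectBoundary _ _ _ _)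
    (image_swap_prod _ _)

theorem approxExtends_unitSquare_of_continuous (hp : HasLocalFillings p)
    (hsurj : Function.Surjective p) {α : ℝ × ℝ → B} (hα : Continuous α) (hε : 0 < ε) :
    ApproxExtends p α (rectBoundary 0 1 0 1) (rect 0 1 0 1) ε := by
  choose ρ hρ h using fun b => hp.exists_approxExtends_rect b hε
  let e : unitInterval × unitInterval → ℝ × ℝ := Prod.map Subtype.val Subtype.val
  obtain ⟨t, ht₀, htm, ⟨m, hm⟩, ht⟩ := exists_monotone_Icc_subset_open_cover_unitInterval_prod_self
    (c := fun s => {w | α (e w) ∈ ball (α (e s)) (ρ (α (e s)))})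
    (fun s => isOpen_ball.preimage (by fun_prop))
    (fun s _ => mem_iUnion.2 ⟨s, mem_ball_self (hρ _)⟩)
  have hle : ∀ n, (t n : ℝ) ≤ t (n + 1) := fun n => htm n.le_succ
  have hcell : ∀ n k, ApproxExtends p α (rectBoundary (t n) (t (n + 1)) (t k) (t (k + 1)))
      (rect (t n) (t (n + 1)) (t k) (t (k + 1))) ε := fun n k => by
    obtain ⟨s, hs⟩ := ht n k
    refine h (α (e s)) α _ _ _ _ (hle n) (hle k) ?_
    rintro ⟨x, y⟩ ⟨hx, hy⟩
    exact hs (a := (⟨x, (t n).2.1.trans hx.1, hx.2.trans (t _).2.2⟩,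
      ⟨y, (t k).2.1.trans hy.1, hy.2.trans (t _).2.2⟩)) ⟨hx, hy⟩
  have hrow : ∀ k n, ApproxExtends p α (rectBoundary 0 (t n) (t k) (t (k + 1)))
      (rect 0 (t n) (t k) (t (k + 1))) ε := fun k n => by
    induction n with
    | zero =>
      rw [rectBoundary_eq_rect_of_eq (.inl (by simp [ht₀]))]
      exact .self hε
    | succ n ih =>
      exact hp.approxExtends_rect_union hsurj hα (t n).2.1 (hle n) (hle k) ih (hcell n k)
  have hcol : ∀ k, ApproxExtends p (α ∘ Prod.swap) (rectBoundary 0 (t k) 0 1)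
      (rect 0 (t k) 0 1) ε := fun k => by
    induction k with
    | zero =>
      rw [rectBoundary_eq_rect_of_eq (.inl (by simp [ht₀]))]
      exact .self hε
    | succ k ih =>
      refine hp.approxExtends_rect_union hsurj (by fun_prop) (t k).2.1 (hle k) zero_le_one ih
        (approxExtends_rect_swap ?_)
      simpa [Function.comp_assoc, hm m le_rfl] using hrow k m
  simpa [hm m le_rfl] using approxExtends_rect_swap (hcol m)

theorem approxExtends_unitSquare (hp : HasLocalFillings p) (hsurj : Function.Surjective p)
    {α : ℝ × ℝ → B} (hα : ContinuousOn α (rect 0 1 0 1)) (hε : 0 < ε) :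
    ApproxExtends p α (rectBoundary 0 1 0 1) (rect 0 1 0 1) ε := by
  let r : ℝ → ℝ := fun t => projIcc (0 : ℝ) 1 zero_le_one t
  have hr : Continuous r := by fun_prop
  refine (hp.approxExtends_unitSquare_of_continuous hsurj (α := α ∘ Prod.map r r)
    (hα.comp_continuous (by fun_prop) fun z => ⟨Subtype.mem _, Subtype.mem _⟩) hε).congr
    (rectBoundary_subset _ _ _ _) ?_
  rintro ⟨x, y⟩ ⟨hx, hy⟩
  simp [r, projIcc_of_mem _ hx, projIcc_of_mem _ hy]

theorem approxExtends_unitInterval (hp : HasLocalFillings p) (hsurj : Function.Surjective p)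
    {α : ℝ → B} (hα : ContinuousOn α (Icc 0 1)) (hε : 0 < ε) :
    ApproxExtends p α {0, 1} (Icc 0 1) ε := by
  let r : ℝ → ℝ := fun t => projIcc (0 : ℝ) 1 zero_le_one t
  have hr : Continuous r := by fun_prop
  refine (hp.approxExtends_Icc hsurj (α := α ∘ r)
    (hα.comp_continuous hr fun z => Subtype.mem _) zero_le_one hε).congr ?_ ?_
  · rintro t (rfl | rfl) <;> simp
  · intro x hx
    simp [r, projIcc_of_mem _ hx]

end HasLocalFillings

section Simplex

open scoped Classical in
/-- The boundary of the simplex spanned by `s`. -/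
noncomputable def simplexBoundary {E : Type*} [AddCommGroup E] [Module ℝ E] (s : Finset E) :
    Set E :=
  ⋃ v ∈ s, convexHull ℝ (s.erase v : Set E)

/-- The parametrization of a triangle by the unit square collapsing one side to the vertex `a`. -/
noncomputable def triangleMap {E : Type*} [AddCommGroup E] [Module ℝ E] (a b c : E) (z : ℝ × ℝ) :
    E :=
  AffineMap.lineMap a (AffineMap.lineMap b c z.1 : E) z.2

variable {E : Type*} [AddCommGroup E] [Module ℝ E] {a b c : E}

theorem simplexBoundary_singleton (a : E) : simplexBoundary {a} = ∅ := by
  simp [simplexBoundary]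

theorem simplexBoundary_pair [DecidableEq E] (hab : a ≠ b) : simplexBoundary {a, b} = {a, b} := by
  have h₁ : (({a, b} : Set E) \ {a}) = {b} := by grind
  have h₂ : (({a, b} : Set E) \ {b}) = {a} := by grind
  simp [simplexBoundary, h₁, h₂]

theorem simplexBoundary_triple [DecidableEq E] (hab : a ≠ b) (hac : a ≠ c) (hbc : b ≠ c) :
    simplexBoundary {a, b, c} = segment ℝ b c ∪ (segment ℝ a c ∪ segment ℝ a b) := by
  have h₁ : (({a, b, c} : Set E) \ {a}) = {b, c} := by grind
  have h₂ : (({a, b, c} : Set E) \ {b}) = {a, c} := by grind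
  have h₃ : (({a, b, c} : Set E) \ {c}) = {a, b} := by grind
  simp [simplexBoundary, h₁, h₂, h₃, convexHull_pair]

theorem image_triangleMap_rect (a b c : E) :
    triangleMap a b c '' rect 0 1 0 1 = convexHull ℝ {a, b, c} := by
  rw [convexHull_insert (by simp), convexHull_pair, convexJoin_singleton_left]
  ext u
  simp only [segment_eq_image_lineMap, mem_iUnion, mem_image, exists_prop, triangleMap, Prod.exists]
  constructor
  · rintro ⟨s, t, ⟨hs, ht⟩, rfl⟩
    exact ⟨_, ⟨s, hs, rfl⟩, t, ht, rfl⟩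
  · rintro ⟨_, ⟨s, hs, rfl⟩, t, ht, rfl⟩
    exact ⟨s, t, ⟨hs, ht⟩, rfl⟩

theorem image_triangleMap_rectBoundary (a b c : E) :
    triangleMap a b c '' rectBoundary 0 1 0 1 =
      segment ℝ b c ∪ (segment ℝ a c ∪ segment ℝ a b) := by
  simp only [segment_eq_image_lineMap]
  apply Subset.antisymm
  · rintro _ ⟨⟨s, t⟩, ⟨⟨hs, ht⟩, h⟩, rfl⟩
    simp only at h hs ht
    rcases h with rfl | rfl | rfl | rfl
    · exact .inr (.inr ⟨t, ht, by simp [triangleMap]⟩)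
    · exact .inr (.inl ⟨t, ht, by simp [triangleMap]⟩)
    · exact .inr (.inl ⟨0, by simp, by simp [triangleMap]⟩)
    · exact .inl ⟨s, hs, by simp [triangleMap]⟩
  · rintro _ (⟨t, ht, rfl⟩ | ⟨t, ht, rfl⟩ | ⟨t, ht, rfl⟩)
    · exact ⟨(t, 1), ⟨⟨ht, by simp⟩, by simp⟩, by simp [triangleMap]⟩
    · exact ⟨(1, t), ⟨⟨by simp, ht⟩, by simp⟩, by simp [triangleMap]⟩
    · exact ⟨(0, t), ⟨⟨by simp, ht⟩, by simp⟩, by simp [triangleMap]⟩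

theorem eq_or_of_triangleMap_eq (h : AffineIndependent ℝ ![a, b, c]) {z w : ℝ × ℝ}
    (hzw : triangleMap a b c z = triangleMap a b c w) : z = w ∨ z.2 = 0 ∧ w.2 = 0 := by
  have key := affineIndependent_iff.1 h Finset.univ
    ![w.2 - z.2, z.2 * (1 - z.1) - w.2 * (1 - w.1), z.2 * z.1 - w.2 * w.1]
    (by simp [Fin.sum_univ_three]; ring) (by
      simp only [triangleMap, AffineMap.lineMap_apply_module] at hzw
      rw [← sub_eq_zero] at hzw
      simp only [Fin.sum_univ_three, Matrix.cons_val]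
      rw [← hzw]
      module)
  have h₀ : w.2 - z.2 = 0 := key 0 (Finset.mem_univ _)
  have h₂ : z.2 * z.1 - w.2 * w.1 = 0 := key 2 (Finset.mem_univ _)
  have h₃ : w.2 = z.2 := sub_eq_zero.1 h₀
  rw [h₃, ← mul_sub] at h₂
  rcases mul_eq_zero.1 h₂ with h | h
  · exact .inr ⟨h, h₃.trans h⟩
  · exact .inl (Prod.ext (sub_eq_zero.1 h) h₃.symm)

variable {X B : Type*} [TopologicalSpace X] [MetricSpace B] {p : X → B} {ε : ℝ}

theorem HasLocalFillings.approxExtends_simplex [TopologicalSpace E] [IsTopologicalAddGroup E]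
    [ContinuousSMul ℝ E] [T2Space E]
    (hp : HasLocalFillings p) (hsurj : Function.Surjective p) {s : Finset E} (hs : s.Nonempty)
    (hcard : s.card ≤ 3) (hind : AffineIndependent ℝ ((↑) : s → E)) {α : E → B}
    (hα : ContinuousOn α (convexHull ℝ (s : Set E))) (hε : 0 < ε) :
    ApproxExtends p α (simplexBoundary s) (convexHull ℝ (s : Set E)) ε := by
  classical
  have hpos := hs.card_pos
  obtain h | h | h : s.card = 1 ∨ s.card = 2 ∨ s.card = 3 := by omega
  · obtain ⟨a, rfl⟩ := Finset.card_eq_one.1 h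
    rw [simplexBoundary_singleton, Finset.coe_singleton, convexHull_singleton]
    exact .singleton hsurj hε a
  · obtain ⟨a, b, hab, rfl⟩ := Finset.card_eq_two.1 h
    have himg : AffineMap.lineMap a b '' Icc (0 : ℝ) 1 =
        convexHull ℝ (({a, b} : Finset E) : Set E) := by
      rw [← segment_eq_image_lineMap, ← convexHull_pair, Finset.coe_pair]
    have hcont : Continuous (AffineMap.lineMap a b : ℝ → E) := AffineMap.lineMap_continuous
    rw [simplexBoundary_pair hab]
    refine (hp.approxExtends_unitInterval hsurj (hα.comp hcont.continuousOn ?_) hε).image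
      isCompact_Icc ?_ hcont.continuousOn
      (fun z _ w _ hzw => .inl (AffineMap.lineMap_injective ℝ hab hzw)) (by simp [image_pair]) himg
    · rw [← himg]
      exact mapsTo_image _ _
    · rintro t (rfl | rfl) <;> simp
  · obtain ⟨a, b, c, hab, hac, hbc, rfl⟩ := Finset.card_eq_three.1 h
    have hcont : Continuous (triangleMap a b c) := by
      unfold triangleMap
      simp only [AffineMap.lineMap_apply_module]
      fun_prop
    have himg : triangleMap a b c '' rect 0 1 0 1 =
        convexHull ℝ (({a, b, c} : Finset E) : Set E) := by
      rw [image_triangleMap_rect]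
      simp
    have hind' : AffineIndependent ℝ ![a, b, c] := by
      let f : Fin 3 ↪ ({a, b, c} : Finset E) :=
        ⟨![⟨a, by simp⟩, ⟨b, by simp⟩, ⟨c, by simp⟩], by
          intro i j hij
          fin_cases i <;> fin_cases j <;> simp_all⟩
      have hf : (fun x : ({a, b, c} : Finset E) => (x : E)) ∘ f = ![a, b, c] := by
        ext i
        fin_cases i <;> rfl
      exact hf ▸ hind.comp_embedding f
    refine (hp.approxExtends_unitSquare hsurj (hα.comp hcont.continuousOn ?_) hε).image
      (isCompact_rect _ _ _ _) (rectBoundary_subset _ _ _ _) hcont.continuousOn ?_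
      ((image_triangleMap_rectBoundary a b c).trans (simplexBoundary_triple hab hac hbc).symm) himg
    · rw [← himg]
      exact mapsTo_image _ _
    · intro z hz w hw hzw
      exact (eq_or_of_triangleMap_eq hind' hzw).imp_right fun h =>
        ⟨⟨hz, .inr (.inr (.inl h.1))⟩, ⟨hw, .inr (.inr (.inl h.2))⟩⟩

end Simplex

section Complex

open Geometry

variable {E : Type*} [NormedAddCommGroup E] [NormedSpace ℝ E]
  {X B : Type*} [TopologicalSpace X] [MetricSpace B] {p : X → B}
  {K K₀ : SimplicialComplex ℝ E}

/-- The polyhedron of `K₀` together with the `k`-vertex faces of `K` for small `k`. -/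
def relSkeleton (K K₀ : SimplicialComplex ℝ E) (k : ℕ) : Set (Finset E) :=
  K₀.faces ∪ {s ∈ K.faces | s.card ≤ k}

theorem isClosed_biUnion_convexHull {S : Set (Finset E)} (hS : S.Finite) :
    IsClosed (⋃ s ∈ S, convexHull ℝ (s : Set E)) :=
  hS.isClosed_biUnion fun s _ => s.finite_toSet.isClosed_convexHull ℝ

theorem convexHull_inter_subset_simplexBoundary {s t : Finset E} (hs : s ∈ K.faces)
    (ht : t ∈ K.faces) (hst : ¬ s ⊆ t) :
    convexHull ℝ (t : Set E) ∩ convexHull ℝ (s : Set E) ⊆ simplexBoundary s := by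
  classical
  obtain ⟨v, hvs, hvt⟩ := Finset.not_subset.1 hst
  refine (K.inter_subset_convexHull ht hs).trans (subset_trans (convexHull_mono ?_)
    (subset_biUnion_of_mem (u := fun v => convexHull ℝ (s.erase v : Set E)) hvs))
  rintro x ⟨hxt, hxs⟩
  exact Finset.mem_coe.2 (Finset.mem_erase.2 ⟨fun h => hvt (h ▸ hxt), hxs⟩)

theorem simplexBoundary_subset_relSkeleton {k : ℕ} {s : Finset E} (hs : s ∈ K.faces)
    (hk : s.card = k + 1) :
    simplexBoundary s ⊆ ⋃ t ∈ relSkeleton K K₀ k, convexHull ℝ (t : Set E) := by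
  classical
  refine iUnion₂_subset fun v hv => ?_
  rcases (s.erase v).eq_empty_or_nonempty with h | h
  · simp [h]
  · exact subset_biUnion_of_mem (u := fun t : Finset E => convexHull ℝ (t : Set E))
      (.inr ⟨K.down_closed hs (s.erase_subset v) h, by rw [Finset.card_erase_of_mem hv]; omega⟩)

/-- Approximate lifts extend over finitely many cells of the same dimension. -/
theorem exists_extend_cells {α : E → B} {k : ℕ} {ε η : ℝ} (hK : K.faces.Finite)
    (hK₀ : K₀.faces ⊆ K.faces) (hηε : η ≤ ε) {g : E → X}
    (hg : ContinuousOn g (⋃ s ∈ relSkeleton K K₀ k, convexHull ℝ (s : Set E)))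
    (hgα : ∀ u ∈ ⋃ s ∈ relSkeleton K K₀ k, convexHull ℝ (s : Set E), dist (p (g u)) (α u) < η)
    (hext : ∀ s ∈ K.faces, ∀ f : E → X, ContinuousOn f (simplexBoundary s) →
      (∀ z ∈ simplexBoundary s, dist (p (f z)) (α z) < η) →
      ∃ F : E → X, ContinuousOn F (convexHull ℝ (s : Set E)) ∧ EqOn F f (simplexBoundary s) ∧
        ∀ z ∈ convexHull ℝ (s : Set E), dist (p (F z)) (α z) < ε)
    (Q : Finset (Finset E)) (hQ : ∀ s ∈ Q, s ∈ K.faces ∧ s ∉ K₀.faces ∧ s.card = k + 1) :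
    ∃ G : E → X,
      ContinuousOn G (⋃ s ∈ relSkeleton K K₀ k ∪ Q, convexHull ℝ (s : Set E)) ∧
      EqOn G g (⋃ s ∈ relSkeleton K K₀ k, convexHull ℝ (s : Set E)) ∧
      ∀ u ∈ ⋃ s ∈ relSkeleton K K₀ k ∪ Q, convexHull ℝ (s : Set E),
        dist (p (G u)) (α u) < ε := by
  classical
  have hTK : relSkeleton K K₀ k ⊆ K.faces := union_subset hK₀ fun s hs => hs.1
  induction Q using Finset.induction_on with
  | empty =>
    simp only [Finset.coe_empty, union_empty]
    exact ⟨g, hg, fun _ _ => rfl, fun u hu => (hgα u hu).trans_le hηε⟩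
  | insert s Q hsQ ih =>
    obtain ⟨G, hG, hGg, hGα⟩ := ih fun t ht => hQ t (Finset.mem_insert_of_mem ht)
    obtain ⟨hsK, hsK₀, hsk⟩ := hQ s (Finset.mem_insert_self s Q)
    have hbd := simplexBoundary_subset_relSkeleton (K₀ := K₀) hsK hsk
    have hsub : relSkeleton K K₀ k ∪ Q ⊆ K.faces :=
      union_subset hTK fun t ht => (hQ t (Finset.mem_insert_of_mem ht)).1
    obtain ⟨F, hF, hFg, hFα⟩ := hext s hsK g (hg.mono hbd) fun z hz => hgα z (hbd hz)
    have hagree : EqOn G F ((⋃ t ∈ relSkeleton K K₀ k ∪ Q, convexHull ℝ (t : Set E)) ∩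
        convexHull ℝ (s : Set E)) := by
      rintro u ⟨hu, hus⟩
      obtain ⟨t, ht, hut⟩ := mem_iUnion₂.1 hu
      have hst : ¬ s ⊆ t := by
        intro hst
        have hcard := Finset.card_le_card hst
        rcases ht with (ht | ht) | ht
        · exact hsK₀ (K₀.down_closed ht hst (K.nonempty_of_mem_faces hsK))
        · have := ht.2
          omega
        · have htk := (hQ t (Finset.mem_insert_of_mem ht)).2.2
          exact hsQ (Finset.eq_of_subset_of_card_le hst (by omega) ▸ ht)
      have hu' := convexHull_inter_subset_simplexBoundary hsK (hsub ht) hst ⟨hut, hus⟩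
      rw [hGg (hbd hu'), hFg hu']
    obtain ⟨H, hH, hHG, hHF⟩ := exists_continuousOn_union
      (isClosed_biUnion_convexHull (hK.subset hsub)) (s.finite_toSet.isClosed_convexHull ℝ)
      hG hF hagree
    have hunion : (⋃ t ∈ relSkeleton K K₀ k ∪ ↑(insert s Q), convexHull ℝ (t : Set E)) =
        (⋃ t ∈ relSkeleton K K₀ k ∪ Q, convexHull ℝ (t : Set E)) ∪
          convexHull ℝ (s : Set E) := by
      rw [Finset.coe_insert, union_insert, biUnion_insert, union_comm]
    rw [hunion]
    refine ⟨H, hH, fun u hu => ?_, ?_⟩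
    · rw [hHG (biUnion_subset_biUnion_left subset_union_left hu), hGg hu]
    · rintro u (hu | hu)
      · rw [hHG hu]; exact hGα u hu
      · rw [hHF hu]; exact hFα u hu

theorem HasLocalFillings.exists_lift_relSkeleton (hp : HasLocalFillings p)
    (hsurj : Function.Surjective p) (hK : K.faces.Finite) (hcard : ∀ s ∈ K.faces, s.card ≤ 3)
    (hK₀ : K₀.faces ⊆ K.faces) {α : E → B} (hα : ContinuousOn α K.space) {α₀ : E → X}
    (hα₀ : ContinuousOn α₀ K₀.space) (hαα₀ : ∀ u ∈ K₀.space, p (α₀ u) = α u) (k : ℕ) {ε : ℝ}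
    (hε : 0 < ε) :
    ∃ g : E → X, ContinuousOn g (⋃ s ∈ relSkeleton K K₀ k, convexHull ℝ (s : Set E)) ∧
      EqOn g α₀ K₀.space ∧
      ∀ u ∈ ⋃ s ∈ relSkeleton K K₀ k, convexHull ℝ (s : Set E), dist (p (g u)) (α u) < ε := by
  classical
  induction k generalizing ε with
  | zero =>
    have h : relSkeleton K K₀ 0 = K₀.faces := by
      refine union_eq_left.2 fun s hs => ?_
      have := (K.nonempty_of_mem_faces hs.1).card_pos
      have := hs.2
      omega
    rw [h]
    exact ⟨α₀, hα₀, fun _ _ => rfl, fun u hu => by rw [hαα₀ u hu, dist_self]; exact hε⟩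
  | succ k ih =>
    have hev : ∀ᶠ η in nhdsWithin (0 : ℝ) (Ioi 0), ∀ s ∈ K.faces, ∀ f : E → X,
        ContinuousOn f (simplexBoundary s) →
        (∀ z ∈ simplexBoundary s, dist (p (f z)) (α z) < η) →
        ∃ F : E → X, ContinuousOn F (convexHull ℝ (s : Set E)) ∧ EqOn F f (simplexBoundary s) ∧
          ∀ z ∈ convexHull ℝ (s : Set E), dist (p (F z)) (α z) < ε := by
      rw [Filter.eventually_all_finite hK]
      intro s hs
      obtain ⟨η, hη, h⟩ := hp.approxExtends_simplex hsurj (K.nonempty_of_mem_faces hs)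
        (hcard s hs) (K.indep hs) (hα.mono (K.convexHull_subset_space hs)) hε
      filter_upwards [Ioo_mem_nhdsGT hη] with η' hη' f hf hfα
      exact h f hf fun z hz => (hfα z hz).trans hη'.2
    obtain ⟨η, hext, hη⟩ := (hev.and (Ioo_mem_nhdsGT hε)).exists
    obtain ⟨g, hg, hgα₀, hgα⟩ := ih hη.1
    have hfin : {s ∈ K.faces | s ∉ K₀.faces ∧ s.card = k + 1}.Finite := hK.subset fun s hs => hs.1
    obtain ⟨G, hG, hGg, hGα⟩ := exists_extend_cells hK hK₀ hη.2.le hg hgα hext hfin.toFinset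
      fun s hs => hfin.mem_toFinset.1 hs
    have h : relSkeleton K K₀ (k + 1) = relSkeleton K K₀ k ∪ hfin.toFinset := by
      ext s
      have := @hK₀ s
      simp only [relSkeleton, Finite.coe_toFinset, mem_union, mem_ofPred_eq]
      grind
    rw [h]
    refine ⟨G, hG, fun u hu => ?_, hGα⟩
    rw [hGg (biUnion_subset_biUnion_left subset_union_left hu), hgα₀ hu]

end Complex

/-- Daverman's approximate lifting theorem (special case): a continuous closed
surjection of metric spaces with compact `UV¹` point-inverses is a `UV¹` map. -/
theorem uv1_decomposition_map {X B : Type*} [MetricSpace X] [MetricSpace B]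
    (p : X → B) (hp_cont : Continuous p) (hp_closed : IsClosedMap p)
    (hp_surj : Function.Surjective p)
    (h_cpt : ∀ b : B, IsCompact (p ⁻¹' {b}))
    (h_uv1 : ∀ b : B, IsUV1Subset (p ⁻¹' {b})) :
    IsUV1Map p := by
  classical
  intro δ hδ n K K₀ hK hcard hK₀ α₀ α hα₀ hα hαα₀
  rcases isEmpty_or_nonempty K.space with hempty | ⟨⟨u₀⟩⟩
  · exact ⟨fun u => hempty.elim u, continuous_of_const fun u => hempty.elim u,
      fun u hu => hempty.elim ⟨u, hu⟩, fun u => hempty.elim u⟩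
  obtain ⟨x₀, -⟩ := hp_surj (α u₀)
  have hspace : K₀.space ⊆ K.space := biUnion_subset_biUnion_left hK₀
  let β : EuclideanSpace ℝ (Fin n) → B := Function.extend Subtype.val α fun _ => α u₀
  let β₀ : EuclideanSpace ℝ (Fin n) → X := Function.extend Subtype.val α₀ fun _ => x₀
  have hβ : ∀ u : K.space, β u = α u := Subtype.val_injective.extend_apply _ _
  have hβ₀ : ∀ u : K₀.space, β₀ u = α₀ u := Subtype.val_injective.extend_apply _ _
  obtain ⟨g, hg, hgβ₀, hgβ⟩ :=
    (hasLocalFillings_of_isUV1Subset hp_cont hp_closed h_uv1).exists_lift_relSkeleton hp_surj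
      hK hcard hK₀ (α := β) (α₀ := β₀)
      (continuousOn_iff_continuous_domRestrict.2 (hα.congr fun u => (hβ u).symm))
      (continuousOn_iff_continuous_domRestrict.2 (hα₀.congr fun u => (hβ₀ u).symm))
      (fun u hu => by rw [hβ₀ ⟨u, hu⟩, hβ ⟨u, hspace hu⟩, hαα₀ ⟨u, hu⟩]) 3 hδ
  have hskel : relSkeleton K K₀ 3 = K.faces :=
    (union_subset hK₀ fun s hs => hs.1).antisymm fun s hs => .inr ⟨hs, hcard s hs⟩
  rw [hskel] at hg hgβ
  refine ⟨fun u => g u, hg.comp_continuous continuous_subtype_val fun u => u.2,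
    fun u hu => (hgβ₀ u.2).trans (hβ₀ u), fun u => ?_⟩
  rw [← hβ u]
  exact hgβ u u.2
end
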